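/- arXiv:1705.08657 — 4 statements merged into one kernel-verified Lean document; each statement's English description precedes it below -/
import Mathlib

section
/- Consider a combinatorial n-fold IP: let D ∈ ℤ^{r×t}, E = (D; 1ᵀ), b ∈ ℤ^{r+n}, l, u ∈ ℤ^{nt} with l ≤ u, and let f : ℝ^{nt} → ℝ be separable convex. Let Δ = 1 + ‖D‖_∞ (maximum absolute entry of D) and g(E) := t²(2rΔ)^r. Suppose the integer program min{f(x) : E^{(n)}x = b, l ≤ x ≤ u, x ∈ ℤ^{nt}} is feasible and the continuous relaxation min{f(x) : E^{(n)}x = b, l ≤ x ≤ u, x ∈ ℝ^{nt}} has an optimal solution. Then there exist l̂, û ∈ ℤ^{nt} with l ≤ l̂ ≤ û ≤ u and ‖û − l̂‖_∞ ≤ 2nt·g(E) + 1 such that min{f(x) : E^{(n)}x = b, l ≤ x ≤ u, x ∈ ℤ^{nt}} = min{f(x) : E^{(n)}x = b, l̂ ≤ x ≤ û, x ∈ ℤ^{nt}}. -/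
/-- The `n`-fold product `E^{(n)}` of the bimatrix `E = (D; A)`. -/
def nFold {r s t : ℕ} (n : ℕ) (D : Matrix (Fin r) (Fin t) ℤ)
    (A : Matrix (Fin s) (Fin t) ℤ) :
    Matrix (Fin r ⊕ (Fin n × Fin s)) (Fin n × Fin t) ℤ :=
  Matrix.of fun I q =>
    match I with
    | Sum.inl a => D a q.2
    | Sum.inr ia => if q.1 = ia.1 then A ia.2 q.2 else 0

/-- The `1 × t` all-ones row matrix `1ᵀ`. -/
def onesRow (t : ℕ) : Matrix (Fin 1) (Fin t) ℤ := Matrix.of fun _ _ => 1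

/-- The maximum absolute value `‖D‖_∞` of an entry of `D`, as a natural number. -/
def matInfNorm {r t : ℕ} (D : Matrix (Fin r) (Fin t) ℤ) : ℕ :=
  Finset.univ.sup fun q : Fin r × Fin t => (D q.1 q.2).natAbs

/-- A separable convex real function: a sum of univariate convex functions of
the individual coordinates. -/
def SepConvexR {ι : Type*} [Fintype ι] (f : (ι → ℝ) → ℝ) : Prop :=
  ∃ F : ι → ℝ → ℝ, (∀ i, ConvexOn ℝ Set.univ (F i)) ∧ ∀ x, f x = ∑ i, F i (x i)

open Matrix in
lemma dotProduct_eq_zero_of_mem_span {ι β : Type*} [Fintype β] {v : ι → β → ℝ} {w x : β → ℝ}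
    (h : ∀ i, v i ⬝ᵥ w = 0) (hx : x ∈ Submodule.span ℝ (Set.range v)) : x ⬝ᵥ w = 0 := by
  induction hx using Submodule.span_induction with
  | mem x hx => obtain ⟨i, rfl⟩ := hx; exact h i
  | zero => simp
  | add x y _ _ hx hy => rw [add_dotProduct, hx, hy, add_zero]
  | smul a x _ hx => rw [smul_dotProduct, hx, smul_zero]

open Matrix in
/-- Siegel's lemma with no rank or size assumption: an integer matrix with a nonzero real kernel
vector has a small nonzero integer kernel vector. -/
lemma exists_small_int_kernel_vector {α β : Type*} [Fintype α] [Fintype β]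
    (A : Matrix α β ℤ) {y : β → ℝ} (hy : y ≠ 0) (hAy : A.map (Int.cast : ℤ → ℝ) *ᵥ y = 0)
    {B : ℕ} (hB1 : 1 ≤ B) (hB : ∀ a b, |A a b| ≤ B) :
    ∃ w : β → ℤ, w ≠ 0 ∧ A *ᵥ w = 0 ∧
      ∀ b, |w b| ≤ (((Fintype.card α + 1) * B) ^ Fintype.card α : ℕ) := by
  classical
  obtain ⟨κ, a, ha, hsp, hli⟩ := exists_linearIndependent' ℝ (A.map (Int.cast : ℤ → ℝ)).row
  have : Fintype κ := @Fintype.ofFinite κ (Finite.of_injective a ha)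
  have hcα : Fintype.card κ ≤ Fintype.card α := Fintype.card_le_of_injective a ha
  have hcβ : Fintype.card κ + 1 ≤ Fintype.card β := by
    have h1 := hli.fintype_card_le_finrank
    rw [Module.finrank_fintype_fun_eq_card] at h1
    refine lt_of_le_of_ne h1 fun h2 => hy ?_
    have h3 := hli.span_eq_top_of_card_eq_finrank' (by simpa using h2)
    have h4 : y ⬝ᵥ y = 0 :=
      dotProduct_eq_zero_of_mem_span (fun k => congrFun hAy (a k)) (h3 ▸ Submodule.mem_top)
    exact dotProduct_self_eq_zero.mp h4
  obtain ⟨e⟩ : Nonempty (Fin (Fintype.card κ + 1) ↪ β) :=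
    Function.Embedding.nonempty_of_card_le (by simpa using hcβ)
  obtain ⟨w, hw0, hw, hwB⟩ : ∃ w : Fin (Fintype.card κ + 1) → ℤ, w ≠ 0 ∧
      A.submatrix a e *ᵥ w = 0 ∧
        ∀ b, |w b| ≤ (((Fintype.card κ + 1) * B) ^ Fintype.card κ : ℕ) := by
    rcases Nat.eq_zero_or_pos (Fintype.card κ) with h0 | hpos
    · have := Fintype.card_eq_zero_iff.mp h0
      exact ⟨1, one_ne_zero, Subsingleton.elim _ _, by simp⟩
    · let := Matrix.seminormedAddCommGroup (m := κ) (n := Fin (Fintype.card κ + 1)) (α := ℤ)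
      obtain ⟨w, hw0, hw, hwB⟩ := Int.Matrix.exists_ne_zero_int_vec_norm_le (A.submatrix a e)
        (by simp) hpos
      refine ⟨w, hw0, hw, fun b => ?_⟩
      have h1 : max 1 ‖A.submatrix a e‖ ≤ (B : ℝ) := by
        refine max_le (by exact_mod_cast hB1) ((Matrix.norm_le_iff B.cast_nonneg).mpr ?_)
        intro i j
        rw [submatrix_apply, Int.norm_eq_abs]
        exact_mod_cast hB _ _
      have h2 := (norm_le_pi_norm w b).trans hwB
      simp only [Fintype.card_fin, Nat.cast_add, Nat.cast_one, add_sub_cancel_left, div_one,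
        Real.rpow_natCast] at h2
      have h3 : ‖w b‖ ≤ (((Fintype.card κ : ℝ) + 1) * B) ^ Fintype.card κ :=
        h2.trans (by gcongr)
      rw [Int.norm_eq_abs] at h3
      exact_mod_cast h3
  have hext : ∀ j, Function.extend e w 0 (e j) = w j := e.injective.extend_apply w 0
  have hbound : ((Fintype.card κ + 1) * B) ^ Fintype.card κ ≤
      ((Fintype.card α + 1) * B) ^ Fintype.card α :=
    (Nat.pow_le_pow_left (by gcongr) _).trans (Nat.pow_le_pow_right (by positivity) hcα)
  refine ⟨Function.extend e w 0, fun h => hw0 (funext fun j => ?_), ?_, fun b => ?_⟩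
  · rw [← hext, h]; rfl
  · have hk : ∀ k, (A *ᵥ Function.extend e w 0) (a k) = 0 := fun k => by
      refine Eq.trans ?_ (congrFun hw k)
      simp only [mulVec, dotProduct, submatrix_apply]
      refine (Finset.sum_of_injOn e e.injective.injOn (by simp) (fun b _ hb => ?_)
        fun j _ => by rw [hext]).symm
      rw [Function.extend_apply' _ _ _ (by simpa using hb), Pi.zero_apply, mul_zero]
    have hcast : ∀ i, (A.map (Int.cast : ℤ → ℝ)).row i ⬝ᵥ
        (fun b => ((Function.extend e w 0 b : ℤ) : ℝ)) = ((A *ᵥ Function.extend e w 0) i : ℝ) := fun i => by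
      simp [mulVec, dotProduct]
    funext i
    have := dotProduct_eq_zero_of_mem_span (x := (A.map (Int.cast : ℤ → ℝ)).row i)
      (fun k => (hcast (a k)).trans (by rw [hk, Int.cast_zero]))
      (hsp ▸ Submodule.subset_span ⟨i, rfl⟩)
    rw [hcast] at this
    exact_mod_cast this
  · by_cases hb : ∃ j, e j = b
    · obtain ⟨j, rfl⟩ := hb
      rw [hext]
      exact (hwB j).trans (by exact_mod_cast hbound)
    · rw [Function.extend_apply' _ _ _ hb]
      simp

open Matrix in
/-- A nonzero real kernel vector has a conformal (sign-compatible) nonzero integer kernel vector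
of norm at most `g`, provided small integer kernel vectors exist in every kernel support. -/
lemma exists_conformal_int_kernel_vector {κ ι : Type*} [Fintype ι] (M : Matrix κ ι ℤ) {g : ℝ}
    (hM : ∀ y : ι → ℝ, y ≠ 0 → M.map (Int.cast : ℤ → ℝ) *ᵥ y = 0 →
      ∃ w : ι → ℤ, w ≠ 0 ∧ M.map (Int.cast : ℤ → ℝ) *ᵥ (fun i => (w i : ℝ)) = 0 ∧
        (∀ i, y i = 0 → w i = 0) ∧ ∀ i, |(w i : ℝ)| ≤ g)
    (y : ι → ℝ) (hy : y ≠ 0) (hMy : M.map (Int.cast : ℤ → ℝ) *ᵥ y = 0) :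
    ∃ w : ι → ℤ, w ≠ 0 ∧ M.map (Int.cast : ℤ → ℝ) *ᵥ (fun i => (w i : ℝ)) = 0 ∧
      (∀ i, y i = 0 → w i = 0) ∧ (∀ i, 0 ≤ y i * w i) ∧ ∀ i, |(w i : ℝ)| ≤ g := by
  classical
  induction hn : (Finset.univ.filter fun i => y i ≠ 0).card using Nat.strong_induction_on
    generalizing y with
  | _ m ih =>
  obtain ⟨w, hw0, hMw, hws, i₀, hi₀, hwg⟩ : ∃ w : ι → ℤ, w ≠ 0 ∧
      M.map (Int.cast : ℤ → ℝ) *ᵥ (fun i => (w i : ℝ)) = 0 ∧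
      (∀ i, y i = 0 → w i = 0) ∧ ∃ i, 0 < y i * w i ∧ ∀ i, |(w i : ℝ)| ≤ g := by
    obtain ⟨w, hw0, hMw, hws, hwg⟩ := hM y hy hMy
    obtain ⟨i, hi⟩ := Function.ne_iff.mp hw0
    have hyi : y i ≠ 0 := fun h => hi (hws i h)
    have hprod : y i * w i ≠ 0 := mul_ne_zero hyi (by exact_mod_cast hi)
    rcases lt_or_gt_of_ne hprod with h | h
    · refine ⟨-w, neg_ne_zero.mpr hw0, ?_, by simpa using hws, i, by simpa using h, by simpa⟩
      have : (fun i => (((-w) i : ℤ) : ℝ)) = -fun i => (w i : ℝ) := by ext; simp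
      rw [this, mulVec_neg, hMw, neg_zero]
    · exact ⟨w, hw0, hMw, hws, i, h, hwg⟩
  obtain ⟨j, hj, hjmin⟩ := (Finset.univ.filter fun i => 0 < y i * w i).exists_min_image
    (fun i => y i / w i) ⟨i₀, by simpa using hi₀⟩
  simp only [Finset.mem_filter, Finset.mem_univ, true_and] at hj hjmin
  have hwj : (w j : ℝ) ≠ 0 := right_ne_zero_of_mul hj.ne'
  have hyj : y j ≠ 0 := left_ne_zero_of_mul hj.ne'
  set s : ℝ := y j / w j with hs
  have hspos : 0 < s := by
    rw [hs, ← mul_div_mul_right _ _ hwj]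
    exact div_pos hj (mul_self_pos.mpr hwj)
  have hconf : ∀ i, 0 ≤ y i * (y i - s * w i) := fun i => by
    by_cases hi : 0 < y i * w i
    · have h1 := hjmin i hi
      have h2 : (w i : ℝ) ≠ 0 := right_ne_zero_of_mul hi.ne'
      have h3 : y i = y i / w i * w i := (div_mul_cancel₀ _ h2).symm
      have h4 : y i * (y i - s * w i) = (y i * w i) * (y i / w i - s) := by
        field_simp
      rw [h4]
      exact mul_nonneg hi.le (by linarith)
    · nlinarith [mul_self_nonneg (y i), mul_nonneg hspos.le (neg_nonneg.mpr (not_lt.mp hi))]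
  by_cases hz : (fun i => y i - s * w i) = 0
  · refine ⟨w, hw0, hMw, hws, fun i => ?_, hwg⟩
    have h1 : y i = s * w i := sub_eq_zero.mp (congrFun hz i)
    rw [h1, mul_assoc]
    exact mul_nonneg hspos.le (mul_self_nonneg _)
  · have hsub : ∀ i, y i = 0 → y i - s * w i = 0 := fun i hi => by simp [hi, hws i hi]
    obtain ⟨c, hc0, hMc, hcs, hcc, hcg⟩ := ih _ (by
        rw [← hn]
        refine Finset.card_lt_card (Finset.ssubset_iff_of_subset ?_ |>.mpr ⟨j, ?_, ?_⟩)
        · intro i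
          simpa using fun h hi => h (hsub i hi)
        · simpa using hyj
        · simp [hs, hwj]) (fun i => y i - s * w i) hz (by
        have : (fun i => y i - s * w i) = y - s • fun i => (w i : ℝ) := by ext; simp
        rw [this, mulVec_sub, mulVec_smul, hMy, hMw, smul_zero, sub_zero]) rfl
    refine ⟨c, hc0, hMc, fun i hi => hcs i (hsub i hi), fun i => ?_, hcg⟩
    by_cases hi : y i - s * w i = 0
    · simp [hcs i hi]
    · have h1 := mul_nonneg (hconf i) (hcc i)
      have h2 : 0 < (y i - s * w i) ^ 2 := by positivity
      by_contra! h
      nlinarith [mul_pos h2 (neg_pos.mpr h)]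

/-- `c` lies between `0` and `y`. -/
def ConformalLE {ι : Type*} (c y : ι → ℝ) : Prop :=
  ∀ i, (0 ≤ c i ∧ c i ≤ y i) ∨ (y i ≤ c i ∧ c i ≤ 0)

lemma ConformalLE.trans {ι : Type*} {a b c : ι → ℝ} (hab : ConformalLE a b)
    (hbc : ConformalLE b c) : ConformalLE a c := fun i => by
  rcases hab i with h | h <;> rcases hbc i with h' | h'
  · exact .inl ⟨h.1, h.2.trans h'.2⟩
  · exact .inr ⟨by linarith, by linarith⟩
  · exact .inl ⟨by linarith, by linarith⟩
  · exact .inr ⟨h'.1.trans h.1, h.2⟩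

open Matrix in
/-- A real kernel vector with no nonzero integer kernel vector below it is short. -/
lemma abs_le_of_forall_not_conformalLE {κ ι : Type*} [Fintype ι] (M : Matrix κ ι ℤ) {g : ℝ}
    (hM : ∀ y : ι → ℝ, y ≠ 0 → M.map (Int.cast : ℤ → ℝ) *ᵥ y = 0 →
      ∃ w : ι → ℤ, w ≠ 0 ∧ M.map (Int.cast : ℤ → ℝ) *ᵥ (fun i => (w i : ℝ)) = 0 ∧
        (∀ i, y i = 0 → w i = 0) ∧ (∀ i, 0 ≤ y i * w i) ∧ ∀ i, |(w i : ℝ)| ≤ g)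
    (y : ι → ℝ) (hMy : M.map (Int.cast : ℤ → ℝ) *ᵥ y = 0)
    (hno : ∀ c : ι → ℤ, M.map (Int.cast : ℤ → ℝ) *ᵥ (fun i => (c i : ℝ)) = 0 →
      ConformalLE (fun i => (c i : ℝ)) y → c = 0) (i : ι) :
    |y i| ≤ (Finset.univ.filter fun i => y i ≠ 0).card * g := by
  classical
  induction hn : (Finset.univ.filter fun i => y i ≠ 0).card using Nat.strong_induction_on
    generalizing y with
  | _ m ih =>
  by_cases hy : y = 0
  · subst hy
    simp at hn
    simp [← hn]
  obtain ⟨w, hw0, hMw, hws, hwc, hwg⟩ := hM y hy hMy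
  have hg : 0 ≤ g := (abs_nonneg _).trans (hwg i)
  obtain ⟨i₀, hi₀⟩ := Function.ne_iff.mp hw0
  obtain ⟨j, hj, hjmin⟩ := (Finset.univ.filter fun i => w i ≠ 0).exists_min_image
    (fun i => y i / w i) ⟨i₀, by simpa using hi₀⟩
  simp only [Finset.mem_filter, Finset.mem_univ, true_and] at hj hjmin
  have hwj : (w j : ℝ) ≠ 0 := by exact_mod_cast hj
  have hyj : y j ≠ 0 := fun h => hj (hws j h)
  set s : ℝ := y j / w j with hs
  have hspos : 0 ≤ s := by
    rw [hs, ← mul_div_mul_right _ _ hwj]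
    exact div_nonneg (hwc j) (mul_self_nonneg _)
  have hsw : ConformalLE (fun i => s * w i) y := fun i => by
    rcases lt_trichotomy (w i : ℝ) 0 with h | h | h
    · have h1 := hjmin i (by exact_mod_cast h.ne)
      rw [le_div_iff_of_neg h] at h1
      exact .inr ⟨h1, mul_nonpos_of_nonneg_of_nonpos hspos h.le⟩
    · rcases le_total 0 (y i) with h' | h'
      · exact .inl (by simp [h, h'])
      · exact .inr (by simp [h, h'])
    · have h1 := hjmin i (by exact_mod_cast h.ne')
      rw [le_div_iff₀ h] at h1
      exact .inl ⟨mul_nonneg hspos h.le, h1⟩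
  have hs1 : s ≤ 1 := by
    by_contra! h
    refine hw0 (hno w hMw (ConformalLE.trans (fun i => ?_) hsw))
    rcases le_total 0 (w i : ℝ) with h' | h'
    · exact .inl ⟨h', by nlinarith⟩
    · exact .inr ⟨by nlinarith, h'⟩
  have hdiff : ConformalLE (fun i => y i - s * w i) y := fun i => by
    rcases hsw i with h | h
    · exact .inl ⟨by linarith, by linarith⟩
    · exact .inr ⟨by linarith, by linarith⟩
  have hlt : (Finset.univ.filter fun i => y i - s * w i ≠ 0).card < m := by
    rw [← hn]
    refine Finset.card_lt_card (Finset.ssubset_iff_of_subset ?_ |>.mpr ⟨j, ?_, ?_⟩)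
    · intro i
      simpa using fun h hi => h (by simp [hi, hws i hi])
    · simpa using hyj
    · simp [hs, hwj]
  have h1 := ih _ hlt (fun i => y i - s * w i) (by
    have : (fun i => y i - s * w i) = y - s • fun i => (w i : ℝ) := by ext; simp
    rw [this, mulVec_sub, mulVec_smul, hMy, hMw, smul_zero, sub_zero])
    (fun c hc hcc => hno c hc (hcc.trans hdiff)) rfl
  have h2 : |s * w i| ≤ g := by
    rw [abs_mul, abs_of_nonneg hspos]
    exact (mul_le_of_le_one_left (abs_nonneg _) hs1).trans (hwg i)
  have h3 : ((Finset.univ.filter fun i => y i - s * w i ≠ 0).card : ℝ) + 1 ≤ m := by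
    exact_mod_cast hlt
  have h4 := abs_add_le (y i - s * w i) (s * w i)
  rw [sub_add_cancel] at h4
  nlinarith [mul_le_mul_of_nonneg_right h3 hg]

lemma ConvexOn.add_sub_le {F : ℝ → ℝ} (hF : ConvexOn ℝ Set.univ F) {x z c : ℝ}
    (h : (0 ≤ c ∧ c ≤ x - z) ∨ (x - z ≤ c ∧ c ≤ 0)) :
    F (z + c) + F (x - c) ≤ F z + F x := by
  by_cases hxz : x - z = 0
  · have : c = 0 := by rcases h with h | h <;> linarith
    simp [this]
  · obtain ⟨a, ha0, ha1, ha⟩ : ∃ a : ℝ, 0 ≤ a ∧ a ≤ 1 ∧ c = a * (x - z) := by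
      refine ⟨c / (x - z), ?_, ?_, (div_mul_cancel₀ _ hxz).symm⟩
      · rcases h with h | h
        · exact div_nonneg h.1 (h.1.trans h.2)
        · exact div_nonneg_of_nonpos h.2 (h.1.trans h.2)
      · rcases h with h | h
        · exact div_le_one_of_le₀ h.2 (h.1.trans h.2)
        · exact div_le_one_of_ge h.1 (h.1.trans h.2)
    have h1 := hF.2 (Set.mem_univ z) (Set.mem_univ x) (sub_nonneg.mpr ha1) ha0 (by ring)
    have h2 := hF.2 (Set.mem_univ z) (Set.mem_univ x) ha0 (sub_nonneg.mpr ha1) (by ring)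
    simp only [smul_eq_mul] at h1 h2
    rw [show z + c = (1 - a) * z + a * x by rw [ha]; ring,
      show x - c = a * z + (1 - a) * x by rw [ha]; ring]
    linarith

open Matrix in
lemma nFold_onesRow_mulVec_eq_zero_iff {r t n : ℕ} (D : Matrix (Fin r) (Fin t) ℤ)
    (y : Fin n × Fin t → ℝ) :
    (nFold n D (onesRow t)).map (Int.cast : ℤ → ℝ) *ᵥ y = 0 ↔
      (∀ a, ∑ q, (D a q.2 : ℝ) * y q = 0) ∧ ∀ i, ∑ j, y (i, j) = 0 := by
  have hbrick : ∀ i k, ((nFold n D (onesRow t)).map (Int.cast : ℤ → ℝ) *ᵥ y) (Sum.inr (i, k)) =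
      ∑ j, y (i, j) := fun i k => by
    simp only [mulVec, dotProduct, nFold, onesRow, map_apply, of_apply, Fintype.sum_prod_type]
    rw [Finset.sum_eq_single i (fun i' _ hi' => by simp [hi']) (by simp)]
    simp
  constructor
  · intro h
    exact ⟨fun a => congrFun h (Sum.inl a), fun i => (hbrick i 0).symm.trans (congrFun h _)⟩
  · rintro ⟨h1, h2⟩
    funext I
    rcases I with a | ⟨i, k⟩
    · exact h1 a
    · exact (hbrick i k).trans (h2 i)

lemma natAbs_le_matInfNorm {r t : ℕ} (D : Matrix (Fin r) (Fin t) ℤ) (a : Fin r) (j : Fin t) :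
    (D a j).natAbs ≤ matInfNorm D :=
  Finset.le_sup (f := fun q : Fin r × Fin t => (D q.1 q.2).natAbs) (Finset.mem_univ (a, j))

/-- Eliminating a base coordinate in every brick. -/
lemma sum_sub_base_mul {r t n : ℕ} {R : Type*} [CommRing R] (D : Matrix (Fin r) (Fin t) R)
    (b : Fin n → Fin t) (x : Fin n × Fin t → R) (a : Fin r) :
    ∑ q, (D a q.2 - D a (b q.1)) * x q =
      ∑ q, D a q.2 * x q - ∑ i, D a (b i) * ∑ j, x (i, j) := by
  simp only [sub_mul, Finset.sum_sub_distrib, Finset.mul_sum, Fintype.sum_prod_type]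

lemma succ_pow_le_four_mul_pow (r : ℕ) : (r + 1) ^ r ≤ 4 * r ^ r := by
  rcases Nat.eq_zero_or_pos r with rfl | hr
  · simp
  have hr' : (0 : ℝ) < r := by exact_mod_cast hr
  have h1 : ((r : ℝ)⁻¹ + 1) ^ r ≤ 4 := calc
    ((r : ℝ)⁻¹ + 1) ^ r ≤ Real.exp ((r : ℝ)⁻¹) ^ r := by
      gcongr; exact Real.add_one_le_exp _
    _ = Real.exp 1 := by rw [← Real.exp_nat_mul, mul_inv_cancel₀ hr'.ne']
    _ ≤ 4 := by linarith [Real.exp_one_lt_d9]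
  have h2 : ((r : ℝ) + 1) ^ r ≤ 4 * (r : ℝ) ^ r := by
    rw [show (r : ℝ) + 1 = ((r : ℝ)⁻¹ + 1) * r by field_simp; ring, mul_pow]
    gcongr
  exact_mod_cast h2

lemma pred_mul_siegel_bound_le (r t m : ℕ) :
    (t - 1) * ((r + 1) * (2 * (1 + m))) ^ r ≤ t ^ 2 * (2 * r * (1 + m)) ^ r := by
  have h1 : (t - 1) * 4 ≤ t ^ 2 := by
    rcases t with _ | t
    · simp
    · simp only [Nat.add_sub_cancel]
      zify
      nlinarith [sq_nonneg ((t : ℤ) - 1)]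
  calc (t - 1) * ((r + 1) * (2 * (1 + m))) ^ r
      = (t - 1) * ((r + 1) ^ r * (2 * (1 + m)) ^ r) := by rw [mul_pow]
    _ ≤ (t - 1) * (4 * r ^ r * (2 * (1 + m)) ^ r) := by gcongr; exact succ_pow_le_four_mul_pow r
    _ = (t - 1) * 4 * (2 * r * (1 + m)) ^ r := by
      rw [show 2 * r * (1 + m) = r * (2 * (1 + m)) by ring, mul_pow r]; ring
    _ ≤ t ^ 2 * (2 * r * (1 + m)) ^ r := by gcongr

open Matrix in
/-- Every kernel support of a combinatorial `n`-fold matrix contains the support of a small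
integer kernel vector. -/
lemma nFold_exists_small_int_kernel_vector {r t n : ℕ} (D : Matrix (Fin r) (Fin t) ℤ)
    (y : Fin n × Fin t → ℝ) (hy : y ≠ 0)
    (hMy : (nFold n D (onesRow t)).map (Int.cast : ℤ → ℝ) *ᵥ y = 0) :
    ∃ w : Fin n × Fin t → ℤ, w ≠ 0 ∧
      (nFold n D (onesRow t)).map (Int.cast : ℤ → ℝ) *ᵥ (fun q => (w q : ℝ)) = 0 ∧
      (∀ q, y q = 0 → w q = 0) ∧
      ∀ q, |(w q : ℝ)| ≤ (t ^ 2 * (2 * r * (1 + matInfNorm D)) ^ r : ℕ) := by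
  classical
  obtain ⟨hD, hone⟩ := (nFold_onesRow_mulVec_eq_zero_iff D y).mp hMy
  obtain ⟨q₀, hq₀⟩ := Function.ne_iff.mp hy
  have hbase : ∀ i, ∃ k, (∃ j, y (i, j) ≠ 0) → y (i, k) ≠ 0 := fun i => by
    by_cases h : ∃ j, y (i, j) ≠ 0
    · obtain ⟨j, hj⟩ := h
      exact ⟨j, fun _ => hj⟩
    · exact ⟨q₀.2, fun h' => absurd h' h⟩
  choose b hb using hbase
  let K := {q : Fin n × Fin t // y q ≠ 0 ∧ q.2 ≠ b q.1}
  have hsumK : ∀ {R : Type} [CommRing R] (x : Fin n × Fin t → R) (c : Fin n × Fin t → R),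
      (∀ q, y q = 0 → x q = 0) → (∀ q, q.2 = b q.1 → c q = 0) →
      ∑ q : K, c q * x q = ∑ q, c q * x q := fun x c hx hc => by
    refine Finset.sum_of_injOn Subtype.val Subtype.val_injective.injOn (by simp)
      (fun q _ hq => ?_) fun _ _ => rfl
    by_cases h1 : y q = 0
    · rw [hx q h1, mul_zero]
    · by_cases h2 : q.2 = b q.1
      · rw [hc q h2, zero_mul]
      · exact absurd ⟨⟨q, h1, h2⟩, by simp, rfl⟩ hq
  let A : Matrix (Fin r) K ℤ := of fun a q => D a q.1.2 - D a (b q.1.1)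
  have hμ0 : (fun q : K => y q) ≠ 0 := fun h => hq₀ <| by
    have h0 : ∀ i j, j ≠ b i → y (i, j) = 0 := fun i j hj => by
      by_contra hij
      exact hij (congrFun h ⟨(i, j), hij, hj⟩)
    obtain ⟨i, j⟩ := q₀
    by_cases hj : j = b i
    · exact (Finset.sum_eq_single j (fun j' _ hj' => h0 i j' (hj ▸ hj')) (by simp)).symm.trans
        (hone i)
    · exact h0 i j hj
  have hAμ : A.map (Int.cast : ℤ → ℝ) *ᵥ (fun q : K => y q) = 0 := funext fun a => by
    have h1 := sum_sub_base_mul (D.map (Int.cast : ℤ → ℝ)) b y a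
    simp only [map_apply, hD, hone, mul_zero, Finset.sum_const_zero, sub_zero] at h1
    rw [← hsumK y (fun q => (D a q.2 : ℝ) - D a (b q.1)) (fun _ h => h)
      (fun q hq => by simp [hq])] at h1
    simpa [A, mulVec, dotProduct] using h1
  obtain ⟨v, hv0, hAv, hvB⟩ := exists_small_int_kernel_vector A hμ0 hAμ
    (B := 2 * (1 + matInfNorm D)) (by omega) (fun a q => by
      have h1 := natAbs_le_matInfNorm D a q.1.2
      have h2 := natAbs_le_matInfNorm D a (b q.1.1)
      simp only [A, of_apply]
      rw [abs_le]
      omega)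
  rw [Fintype.card_fin] at hvB
  obtain ⟨⟨q₁, hq₁⟩, hvq₁⟩ := Function.ne_iff.mp hv0
  let x : Fin n × Fin t → ℤ := fun q => if h : y q ≠ 0 ∧ q.2 ≠ b q.1 then v ⟨q, h⟩ else 0
  have hxK : ∀ q : K, x q = v q := fun q => dif_pos q.2
  have hxy : ∀ q, y q = 0 → x q = 0 := fun q hq => dif_neg fun h => h.1 hq
  have hxb : ∀ q, q.2 = b q.1 → x q = 0 := fun q hq => dif_neg fun h => h.2 hq
  set C : ℕ := ((r + 1) * (2 * (1 + matInfNorm D))) ^ r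
  have hxC : ∀ q, |x q| ≤ (C : ℤ) := fun q => by
    by_cases h : y q ≠ 0 ∧ q.2 ≠ b q.1
    · exact hxK ⟨q, h⟩ ▸ hvB _
    · simp only [x, dif_neg h, abs_zero]
      positivity
  have ht : 1 ≤ t - 1 := by
    have h1 := (q₁.2).isLt
    have h2 := (b q₁.1).isLt
    have h3 := Fin.val_ne_of_ne hq₁.2
    omega
  let w : Fin n × Fin t → ℤ := fun q => x q - if q.2 = b q.1 then ∑ j, x (q.1, j) else 0
  have hw1 : ∀ i, ∑ j, w (i, j) = 0 := fun i => by simp [w]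
  have hwD : ∀ a, ∑ q, D a q.2 * w q = 0 := fun a => by
    have h1 := sum_sub_base_mul D b w a
    simp only [hw1, mul_zero, Finset.sum_const_zero, sub_zero] at h1
    rw [← h1]
    refine Eq.trans ?_ (congrFun hAv a)
    simp only [mulVec, dotProduct, A, of_apply, ← hxK]
    rw [hsumK x (fun q => D a q.2 - D a (b q.1)) hxy (fun q hq => by simp [hq])]
    refine Finset.sum_congr rfl fun q _ => ?_
    by_cases hq : q.2 = b q.1
    · simp [hq]
    · simp [w, hq]
  refine ⟨w, fun h => hvq₁ ?_, ?_, fun q hq => ?_, fun q => ?_⟩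
  · have h1 := congrFun h q₁
    rw [← hxK]
    simpa [w, hq₁.2] using h1
  · refine (nFold_onesRow_mulVec_eq_zero_iff D _).mpr ⟨fun a => ?_, fun i => ?_⟩
    · exact_mod_cast hwD a
    · exact_mod_cast hw1 i
  · by_cases hqb : q.2 = b q.1
    · have h0 : ∀ j, x (q.1, j) = 0 := fun j => hxy _ <| by
        by_contra hj
        exact hb q.1 ⟨j, hj⟩ (hqb ▸ hq)
      simp [w, hxy q hq, h0]
    · simp [w, hxy q hq, hqb]
  · have hCle : ((t - 1) * C : ℕ) ≤ t ^ 2 * (2 * r * (1 + matInfNorm D)) ^ r :=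
      pred_mul_siegel_bound_le r t _
    suffices h : |w q| ≤ ((t - 1) * C : ℕ) by
      have h' := h.trans (Int.ofNat_le.mpr hCle)
      exact_mod_cast h'
    by_cases hqb : q.2 = b q.1
    · simp only [w, hqb, if_true, hxb q hqb, zero_sub, abs_neg]
      rw [← Finset.sum_erase Finset.univ (f := fun j => x (q.1, j)) (hxb (q.1, b q.1) rfl)]
      refine (Finset.abs_sum_le_sum_abs _ _).trans
        ((Finset.sum_le_card_nsmul _ _ _ fun j _ => hxC (q.1, j)).trans_eq ?_)
      simp
    · simp only [w, hqb, if_false, sub_zero]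
      refine (hxC q).trans ?_
      exact_mod_cast Nat.le_mul_of_pos_left C ht

open Matrix in
/-- Proximity: an integer optimum near a given continuous optimum. -/
lemma exists_int_minimizer_near {κ ι : Type*} [Fintype ι] (M : Matrix κ ι ℤ) {g : ℝ} (hg : 0 ≤ g)
    (hM : ∀ y : ι → ℝ, y ≠ 0 → M.map (Int.cast : ℤ → ℝ) *ᵥ y = 0 →
      ∃ w : ι → ℤ, w ≠ 0 ∧ M.map (Int.cast : ℤ → ℝ) *ᵥ (fun i => (w i : ℝ)) = 0 ∧
        (∀ i, y i = 0 → w i = 0) ∧ ∀ i, |(w i : ℝ)| ≤ g)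
    (b : κ → ℤ) (l u : ι → ℤ) {f : (ι → ℝ) → ℝ} (hf : SepConvexR f)
    (hfeas : ∃ z : ι → ℤ, M *ᵥ z = b ∧ (∀ i, l i ≤ z i) ∧ ∀ i, z i ≤ u i)
    {x : ι → ℝ} (hx : M.map (Int.cast : ℤ → ℝ) *ᵥ x = fun I => (b I : ℝ))
    (hlx : ∀ i, (l i : ℝ) ≤ x i) (hxu : ∀ i, x i ≤ (u i : ℝ))
    (hmin : ∀ z : ι → ℝ, M.map (Int.cast : ℤ → ℝ) *ᵥ z = (fun I => (b I : ℝ)) →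
      (∀ i, (l i : ℝ) ≤ z i) → (∀ i, z i ≤ (u i : ℝ)) → f x ≤ f z) :
    ∃ z : ι → ℤ, (M *ᵥ z = b ∧ (∀ i, l i ≤ z i) ∧ ∀ i, z i ≤ u i) ∧
      (∀ z' : ι → ℤ, (M *ᵥ z' = b ∧ (∀ i, l i ≤ z' i) ∧ ∀ i, z' i ≤ u i) →
        f (fun i => (z i : ℝ)) ≤ f fun i => (z' i : ℝ)) ∧
      ∀ i, |x i - z i| ≤ Fintype.card ι * g := by
  classical
  have hcast : ∀ z : ι → ℤ, M.map (Int.cast : ℤ → ℝ) *ᵥ (fun i => (z i : ℝ)) =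
      fun I => ((M *ᵥ z) I : ℝ) := fun z => by
    ext I
    simp [mulVec, dotProduct]
  let S : Finset (ι → ℤ) := (Fintype.piFinset fun i => Finset.Icc (l i) (u i)).filter
    fun z => M *ᵥ z = b
  have hS : ∀ z, z ∈ S ↔ M *ᵥ z = b ∧ (∀ i, l i ≤ z i) ∧ ∀ i, z i ≤ u i := fun z => by
    simp only [S, Finset.mem_filter, Fintype.mem_piFinset, Finset.mem_Icc, forall_and]
    tauto
  obtain ⟨z₀, hz₀⟩ := hfeas
  obtain ⟨z₁, hz₁, hz₁min⟩ := S.exists_min_image (fun z => f fun i => (z i : ℝ))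
    ⟨z₀, (hS _).mpr hz₀⟩
  obtain ⟨z, hz, hzmin⟩ := (S.filter fun z => f (fun i => (z i : ℝ)) ≤
    f fun i => (z₁ i : ℝ)).exists_min_image (fun z => ∑ i, |x i - z i|)
    ⟨z₁, by simpa using hz₁⟩
  rw [Finset.mem_filter] at hz
  obtain ⟨hzM, hlz, hzu⟩ := (hS z).mp hz.1
  have hzopt := fun z' hz' => hz.2.trans (hz₁min z' ((hS z').mpr hz'))
  refine ⟨z, ⟨hzM, hlz, hzu⟩, hzopt, fun i => ?_⟩
  have hbound := abs_le_of_forall_not_conformalLE M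
    (exists_conformal_int_kernel_vector M hM) (fun i => x i - z i) (by
      have : (fun i => x i - (z i : ℝ)) = x - fun i => (z i : ℝ) := rfl
      rw [this, mulVec_sub, hx, hcast, hzM, sub_self]) ?_ i
  · refine hbound.trans (mul_le_mul_of_nonneg_right ?_ hg)
    exact_mod_cast Finset.card_le_univ _
  intro c hMc hc
  have hlz' : ∀ i, (l i : ℝ) ≤ z i := fun i => by exact_mod_cast hlz i
  have hzu' : ∀ i, (z i : ℝ) ≤ u i := fun i => by exact_mod_cast hzu i
  have hzc : z + c ∈ S := by
    refine (hS _).mpr ⟨?_, fun i => ?_, fun i => ?_⟩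
    · have h1 : M *ᵥ c = 0 := funext fun I => by
        have : ((M *ᵥ c) I : ℝ) = 0 := congrFun ((hcast c).symm.trans hMc) I
        exact_mod_cast this
      rw [mulVec_add, hzM, h1, add_zero]
    · have : (l i : ℝ) ≤ z i + c i := by
        rcases hc i with h | h <;> linarith [hlz' i, hlx i]
      exact_mod_cast this
    · have : (z i : ℝ) + c i ≤ u i := by
        rcases hc i with h | h <;> linarith [hzu' i, hxu i]
      exact_mod_cast this
  have hxc : f x ≤ f fun i => x i - c i := by
    refine hmin _ ?_ (fun i => ?_) fun i => ?_
    · have : (fun i => x i - (c i : ℝ)) = x - fun i => (c i : ℝ) := rfl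
      rw [this, mulVec_sub, hx, hMc, sub_zero]
    · rcases hc i with h | h <;> linarith [hlz' i, hlx i]
    · rcases hc i with h | h <;> linarith [hzu' i, hxu i]
  have hexch : (f fun i => (z i : ℝ) + c i) + (f fun i => x i - c i) ≤
      (f fun i => (z i : ℝ)) + f x := by
    obtain ⟨F, hF, hfF⟩ := hf
    simp only [hfF, ← Finset.sum_add_distrib]
    exact Finset.sum_le_sum fun i _ => (hF i).add_sub_le (hc i)
  have hzcopt : (f fun i => ((z + c) i : ℝ)) ≤ f fun i => (z₁ i : ℝ) := by
    simp only [Pi.add_apply, Int.cast_add]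
    linarith [hz.2]
  have hdist := hzmin _ (Finset.mem_filter.mpr ⟨hzc, hzcopt⟩)
  have hterm : ∀ i, |x i - ((z + c) i : ℤ)| = |x i - z i| - |(c i : ℝ)| := fun i => by
    simp only [Pi.add_apply, Int.cast_add]
    rcases hc i with h | h
    · rw [abs_of_nonneg h.1, abs_of_nonneg (h.1.trans h.2), abs_of_nonneg (by linarith)]
      ring
    · rw [abs_of_nonpos h.2, abs_of_nonpos (h.1.trans h.2), abs_of_nonpos (by linarith)]
      ring
  simp only [hterm, Finset.sum_sub_distrib] at hdist
  have hsum : ∑ i, |(c i : ℝ)| = 0 :=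
    le_antisymm (by linarith) (Finset.sum_nonneg fun i _ => abs_nonneg _)
  rw [Finset.sum_eq_zero_iff_of_nonneg fun i _ => abs_nonneg _] at hsum
  funext i
  have := abs_eq_zero.mp (hsum i (Finset.mem_univ i))
  exact_mod_cast this

/-- Equivalent bounded instance for combinatorial `n`-fold IPs: with
`Δ = 1 + ‖D‖_∞` and `g(E) := t²(2rΔ)^r`, there are tightened bounds
`l ≤ l̂ ≤ û ≤ u` with `‖û - l̂‖_∞ ≤ 2nt·g(E) + 1` preserving the optimal value
of the integer program. -/
theorem comb_nfold_equiv_bounded_instance {r t n : ℕ}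
    (D : Matrix (Fin r) (Fin t) ℤ)
    (b : Fin r ⊕ (Fin n × Fin 1) → ℤ) (l u : Fin n × Fin t → ℤ)
    (hlu : ∀ q, l q ≤ u q)
    (f : (Fin n × Fin t → ℝ) → ℝ) (hf : SepConvexR f)
    (hfeas : ∃ z : Fin n × Fin t → ℤ,
      (nFold n D (onesRow t)).mulVec z = b ∧ (∀ q, l q ≤ z q) ∧ (∀ q, z q ≤ u q))
    (hcont : ∃ xhat : Fin n × Fin t → ℝ,
      (((nFold n D (onesRow t)).map (Int.cast : ℤ → ℝ)).mulVec xhat =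
        fun I => (b I : ℝ)) ∧
      (∀ q, (l q : ℝ) ≤ xhat q) ∧ (∀ q, xhat q ≤ (u q : ℝ)) ∧
      (∀ z : Fin n × Fin t → ℝ,
        ((nFold n D (onesRow t)).map (Int.cast : ℤ → ℝ)).mulVec z = (fun I => (b I : ℝ)) →
        (∀ q, (l q : ℝ) ≤ z q) → (∀ q, z q ≤ (u q : ℝ)) → f xhat ≤ f z)) :
    ∃ lhat uhat : Fin n × Fin t → ℤ,
      (∀ q, l q ≤ lhat q) ∧ (∀ q, lhat q ≤ uhat q) ∧ (∀ q, uhat q ≤ u q) ∧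
      (∀ q, uhat q - lhat q ≤
        ((2 * n * t * (t ^ 2 * (2 * r * (1 + matInfNorm D)) ^ r) + 1 : ℕ) : ℤ)) ∧
      sInf {v : ℝ | ∃ x : Fin n × Fin t → ℤ,
          ((nFold n D (onesRow t)).mulVec x = b ∧
            (∀ q, l q ≤ x q) ∧ (∀ q, x q ≤ u q)) ∧
          v = f (fun q => (x q : ℝ))} =
      sInf {v : ℝ | ∃ x : Fin n × Fin t → ℤ,
          ((nFold n D (onesRow t)).mulVec x = b ∧
            (∀ q, lhat q ≤ x q) ∧ (∀ q, x q ≤ uhat q)) ∧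
          v = f (fun q => (x q : ℝ))} := by
  obtain ⟨x, hx, hlx, hxu, hmin⟩ := hcont
  set g : ℕ := t ^ 2 * (2 * r * (1 + matInfNorm D)) ^ r
  obtain ⟨z, ⟨hzM, hlz, hzu⟩, hzopt, hdist⟩ := exists_int_minimizer_near (nFold n D (onesRow t))
    g.cast_nonneg (nFold_exists_small_int_kernel_vector D) b l u hf hfeas hx hlx hxu hmin
  set N : ℤ := n * t * g with hN
  have hdist' : ∀ q, |x q - z q| ≤ (N : ℝ) := fun q => by
    simpa [hN] using hdist q
  have hlz' : ∀ q, max (l q) (⌊x q⌋ - N) ≤ z q := fun q => by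
    refine max_le (hlz q) ?_
    have h1 := (abs_le.mp (hdist' q)).2
    have h2 := Int.floor_le (x q)
    have h3 : ((⌊x q⌋ - N : ℤ) : ℝ) ≤ z q := by push_cast; linarith
    exact_mod_cast h3
  have hzu' : ∀ q, z q ≤ min (u q) (⌈x q⌉ + N) := fun q => by
    refine le_min (hzu q) ?_
    have h1 := (abs_le.mp (hdist' q)).1
    have h2 := Int.le_ceil (x q)
    have h3 : (z q : ℝ) ≤ (⌈x q⌉ + N : ℤ) := by push_cast; linarith
    exact_mod_cast h3
  refine ⟨fun q => max (l q) (⌊x q⌋ - N), fun q => min (u q) (⌈x q⌉ + N),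
    fun q => le_max_left _ _, fun q => (hlz' q).trans (hzu' q), fun q => min_le_left _ _,
    fun q => ?_, ?_⟩
  · have h1 := Int.ceil_le_floor_add_one (x q)
    have h2 := le_max_right (l q) (⌊x q⌋ - N)
    have h3 := min_le_right (u q) (⌈x q⌉ + N)
    have h4 : ((2 * n * t * g + 1 : ℕ) : ℤ) = 2 * N + 1 := by rw [hN]; push_cast; ring
    rw [h4]
    linarith
  · refine Eq.trans (b := f fun q => (z q : ℝ)) ?_ (Eq.symm ?_)
    · refine IsLeast.csInf_eq ⟨⟨z, ⟨hzM, hlz, hzu⟩, rfl⟩, ?_⟩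
      rintro _ ⟨z', hz', rfl⟩
      exact hzopt z' hz'
    · refine IsLeast.csInf_eq ⟨⟨z, ⟨hzM, hlz', hzu'⟩, rfl⟩, ?_⟩
      rintro _ ⟨z', ⟨hz'M, hlz'', hz'u⟩, rfl⟩
      exact hzopt z' ⟨hz'M, fun q => (le_max_left _ _).trans (hlz'' q),
        fun q => (hz'u q).trans (min_le_left _ _)⟩
end

section
/- Let Σ be a finite alphabet, let s_1,…,s_k ∈ Σ^L be strings of length L, and let d ∈ ℕ. For each f ∈ Σ^k let b_f = |{p ∈ [L] : (s_1[p],…,s_k[p]) = f}| be the number of input columns equal to f. Then there exists a string y ∈ Σ^L with Hamming distance d_H(y, s_i) ≤ d for every i ∈ [k] if and only if there exist nonnegative integers x_{f,e} indexed by f ∈ Σ^k and e ∈ Σ such that Σ_{e ∈ Σ} x_{f,e} = b_f for every f ∈ Σ^k, and Σ_{f ∈ Σ^k} Σ_{e ∈ Σ} d_H(e, f_j)·x_{f,e} ≤ d for every j ∈ [k], where d_H(e, f_j) = 1 if e ≠ f_j and 0 otherwise. -/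
open Finset in
/-- Summing a function of the pair `(c p, y p)` over all `p` amounts to summing over all pairs,
weighted by how often they occur. -/
theorem sum_sum_mul_card_filter {α β σ : Type*} [Fintype α] [Fintype β] [DecidableEq β]
    [Fintype σ] [DecidableEq σ] (c : α → β) (y : α → σ) (g : β → σ → ℕ) :
    ∑ f, ∑ e, g f e * #{p | c p = f ∧ y p = e} = ∑ p, g (c p) (y p) := by
  rw [← Fintype.sum_prod_type' fun f e => g f e * #{p | c p = f ∧ y p = e},
    ← Finset.sum_fiberwise univ (fun p => (c p, y p))]
  refine Finset.sum_congr rfl fun ⟨f, e⟩ _ => ?_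
  simp only [Prod.mk.injEq]
  rw [Finset.sum_congr rfl (g := fun _ => g f e) fun p hp => ?_]
  · simp [mul_comm]
  · obtain ⟨rfl, rfl⟩ := (Finset.mem_filter.1 hp).2
    rfl

open Finset in
/-- If `x f` splits the size of each fibre of `c` among the labels `e`, then the domain of `c` can
be labelled so that sums over it are the corresponding `x`-weighted sums. -/
theorem exists_labelling_of_sum_eq_card_fiber {α β σ : Type*} [Fintype α] [Fintype β]
    [DecidableEq β] [Fintype σ] (c : α → β) (x : β → σ → ℕ)
    (hx : ∀ f, ∑ e, x f e = #{p | c p = f}) :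
    ∃ y : α → σ, ∀ g : β → σ → ℕ, ∑ p, g (c p) (y p) = ∑ f, ∑ e, g f e * x f e := by
  have E (f : β) : {p // c p = f} ≃ Σ e, Fin (x f e) :=
    Fintype.equivOfCardEq (by simp [hx, Fintype.card_subtype])
  let Φ : α ≃ Σ f, Σ e, Fin (x f e) :=
    (Equiv.sigmaFiberEquiv c).symm.trans (Equiv.sigmaCongrRight E)
  refine ⟨fun p => (Φ p).2.1, fun g => ?_⟩
  calc ∑ p, g (c p) (Φ p).2.1 = ∑ p, g (Φ p).1 (Φ p).2.1 := rfl
    _ = ∑ z : Σ f, Σ e, Fin (x f e), g z.1 z.2.1 := Φ.sum_comp fun z => g z.1 z.2.1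
    _ = ∑ f, ∑ e, g f e * x f e := by simp [Fintype.sum_sigma, mul_comm]

/-- The Hamming distance as a sum of character distances. -/
theorem hammingDist_eq_sum_ite {ι σ : Type*} [Fintype ι] [DecidableEq σ] (y z : ι → σ) :
    hammingDist y z = ∑ p, if y p = z p then 0 else 1 := by
  simp [hammingDist, Finset.card_filter, ite_not]

/-- The Closest String problem is equivalent to its integer programming
formulation over column types: a string `y` with `d_H(y, s_i) ≤ d` for all `i`
exists iff there are nonnegative integers `x_{f,e}` (for column types
`f ∈ Σ^k` and output characters `e ∈ Σ`) with `Σ_e x_{f,e} = b_f` for every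
`f`, and `Σ_f Σ_e d_H(e, f_j) · x_{f,e} ≤ d` for every `j ∈ [k]`. -/
theorem closestString_ilp_formulation {k L : ℕ} {σ : Type*}
    [Fintype σ] [DecidableEq σ]
    (s : Fin k → Fin L → σ) (d : ℕ) :
    (∃ y : Fin L → σ, ∀ i : Fin k, hammingDist y (s i) ≤ d) ↔
    (∃ x : (Fin k → σ) → σ → ℕ,
      (∀ f : Fin k → σ,
        ∑ e : σ, x f e =
          (Finset.univ.filter fun p : Fin L => (fun i => s i p) = f).card) ∧
      (∀ j : Fin k,
        ∑ f : Fin k → σ, ∑ e : σ, (if e = f j then 0 else 1) * x f e ≤ d)) := by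
  constructor
  · rintro ⟨y, hy⟩
    refine ⟨fun f e =>
      (Finset.univ.filter fun p : Fin L => (fun i => s i p) = f ∧ y p = e).card,
      fun f => ?_, fun j => ?_⟩
    · rw [Finset.card_eq_sum_card_fiberwise (f := y) (t := Finset.univ) (by simp)]
      simp only [Finset.filter_filter]
    · rw [sum_sum_mul_card_filter (fun p i => s i p) y fun f e => if e = f j then 0 else 1,
        ← hammingDist_eq_sum_ite]
      exact hy j
  · rintro ⟨x, hx, hd⟩
    obtain ⟨y, hy⟩ := exists_labelling_of_sum_eq_card_fiber (fun p i => s i p) x hx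
    refine ⟨y, fun j => ?_⟩
    rw [hammingDist_eq_sum_ite]
    exact (hy fun f e => if e = f j then 0 else 1).trans_le (hd j)
end

section
/- Let Σ be a finite alphabet, ⋆ ∉ Σ a wildcard symbol, and let δ : (Σ ∪ {⋆}) × (Σ ∪ {⋆}) → ℕ be a character distance with δ(e, ⋆) = 0 for all e ∈ Σ; extend δ to strings character-wise: δ(x, y) = Σ_{p=1}^L δ(x[p], y[p]). Let s_1,…,s_k ∈ (Σ ∪ {⋆})^L, let d_1,…,d_k, D_1,…,D_k ∈ ℕ, and let b ∈ {0,1}. For each e ∈ (Σ ∪ {⋆})^k let n_e = |{p ∈ [L] : (s_1[p],…,s_k[p]) = e}|. Then: (a) there exists y ∈ Σ^L with d_i ≤ δ(y, s_i) ≤ D_i for all i ∈ [k] if and only if there exist nonnegative integers x_{e,f} indexed by e ∈ (Σ ∪ {⋆})^k and f ∈ Σ with Σ_{f ∈ Σ} x_{e,f} = n_e for every e, and d_i ≤ Σ_{e} Σ_{f ∈ Σ} δ(f, e_i)·x_{e,f} ≤ D_i for every i ∈ [k]; and (b) if such y exists, the minimum of b·Σ_{i=1}^k δ(y, s_i) over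 all such y equals the minimum of b·Σ_{i=1}^k Σ_{e} Σ_{f ∈ Σ} δ(f, e_i)·x_{e,f} over all such integer solutions (x_{e,f}). -/
section MultiStrings

variable {k L : ℕ} {α : Type*} [Fintype α] [DecidableEq α]

/-- The number of input columns equal to the column type `e ∈ (Σ ∪ {⋆})^k`
(the wildcard `⋆` is modelled by `none : Option α`). -/
def colCount (s : Fin k → Fin L → Option α) (e : Fin k → Option α) : ℕ :=
  (Finset.univ.filter fun p : Fin L => (fun i => s i p) = e).card

/-- The character-wise distance `δ(y, s_i)` between the output string `y ∈ Σ^L`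
and the `i`-th input string. -/
def strDist (δ : Option α → Option α → ℕ) (s : Fin k → Fin L → Option α)
    (y : Fin L → α) (i : Fin k) : ℕ :=
  ∑ p, δ (some (y p)) (s i p)

/-- Feasibility of an output string `y`: `d_i ≤ δ(y, s_i) ≤ D_i` for all `i`. -/
def yFeas (δ : Option α → Option α → ℕ) (s : Fin k → Fin L → Option α)
    (d D : Fin k → ℕ) (y : Fin L → α) : Prop :=
  ∀ i, d i ≤ strDist δ s y i ∧ strDist δ s y i ≤ D i

/-- The distance to the `i`-th input string expressed in the ILP variables
`x_{e,f}`. -/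
def ilpDist (δ : Option α → Option α → ℕ) (x : (Fin k → Option α) → α → ℕ)
    (i : Fin k) : ℕ :=
  ∑ e : Fin k → Option α, ∑ f : α, δ (some f) (e i) * x e f

/-- Feasibility of the ILP variables `x_{e,f}`. -/
def xFeas (δ : Option α → Option α → ℕ) (s : Fin k → Fin L → Option α)
    (d D : Fin k → ℕ) (x : (Fin k → Option α) → α → ℕ) : Prop :=
  (∀ e, ∑ f : α, x e f = colCount s e) ∧
  ∀ i, d i ≤ ilpDist δ x i ∧ ilpDist δ x i ≤ D i

/-- A sum over the positions `p` of a function of the column `c p` and the letter `y p` can be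
grouped by the values of these two. -/
theorem sum_eq_sum_card_mul {ι β γ : Type*} [Fintype ι] [Fintype β] [Fintype γ]
    [DecidableEq β] [DecidableEq γ] (c : ι → β) (y : ι → γ) (g : γ → β → ℕ) :
    ∑ p, g (y p) (c p) =
      ∑ e, ∑ f, g f e * (Finset.univ.filter fun p => c p = e ∧ y p = f).card := by
  rw [← Finset.sum_fiberwise Finset.univ c]
  refine Finset.sum_congr rfl fun e _ => ?_
  rw [← Finset.sum_fiberwise _ y]
  refine Finset.sum_congr rfl fun f _ => ?_
  rw [Finset.filter_filter, mul_comm, ← smul_eq_mul]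
  refine Finset.sum_eq_card_nsmul fun p hp => ?_
  obtain ⟨rfl, rfl⟩ := (Finset.mem_filter.mp hp).2
  rfl

/-- Any prescription of multiplicities `x e f` whose row sums are the fiber sizes of `c` is
realised by some labelling `y`. -/
theorem exists_labelling_of_sum_eq_card {ι β γ : Type*} [Fintype ι] [Fintype β]
    [Fintype γ] [DecidableEq β] (c : ι → β) (x : β → γ → ℕ)
    (hx : ∀ e, ∑ f, x e f = (Finset.univ.filter fun p => c p = e).card) :
    ∃ y : ι → γ, ∀ g : γ → β → ℕ, ∑ p, g (y p) (c p) = ∑ e, ∑ f, g f e * x e f := by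
  have hcard (e : β) : Fintype.card {p // c p = e} = Fintype.card (Σ f, Fin (x e f)) := by
    simp [Fintype.card_subtype, hx]
  let φ (e : β) : {p // c p = e} ≃ Σ f, Fin (x e f) := Fintype.equivOfCardEq (hcard e)
  refine ⟨fun p => (φ (c p) ⟨p, rfl⟩).1, fun g => ?_⟩
  rw [← Fintype.sum_fiberwise c]
  refine Finset.sum_congr rfl fun e _ => ?_
  calc ∑ p : {p // c p = e}, g (φ (c p) ⟨p, rfl⟩).1 (c p)
      = ∑ p : {p // c p = e}, g (φ e p).1 e := by
        refine Finset.sum_congr rfl fun p _ => ?_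
        obtain ⟨p, rfl⟩ := p
        rfl
    _ = ∑ q : Σ f, Fin (x e f), g q.1 e := (φ e).sum_comp fun q => g q.1 e
    _ = ∑ f, g f e * x e f := by simp [Fintype.sum_sigma, mul_comm]

theorem exists_xFeas_of_yFeas {δ : Option α → Option α → ℕ} {s : Fin k → Fin L → Option α}
    {d D : Fin k → ℕ} {y : Fin L → α} (hy : yFeas δ s d D y) :
    ∃ x, xFeas δ s d D x ∧ ∀ i, ilpDist δ x i = strDist δ s y i := by
  let x (e : Fin k → Option α) (f : α) : ℕ :=
    (Finset.univ.filter fun p => (fun i => s i p) = e ∧ y p = f).card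
  have hdist (i : Fin k) : ilpDist δ x i = strDist δ s y i :=
    (sum_eq_sum_card_mul (fun p i => s i p) y fun f e => δ (some f) (e i)).symm
  refine ⟨x, ⟨fun e => ?_, fun i => by rw [hdist]; exact hy i⟩, hdist⟩
  rw [colCount, Finset.card_eq_sum_card_fiberwise (f := y) (t := Finset.univ) (by simp)]
  simp [x, Finset.filter_filter]

theorem exists_yFeas_of_xFeas {δ : Option α → Option α → ℕ} {s : Fin k → Fin L → Option α}
    {d D : Fin k → ℕ} {x : (Fin k → Option α) → α → ℕ} (hx : xFeas δ s d D x) :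
    ∃ y, yFeas δ s d D y ∧ ∀ i, strDist δ s y i = ilpDist δ x i := by
  obtain ⟨y, hy⟩ := exists_labelling_of_sum_eq_card (fun p i => s i p) x hx.1
  have hdist (i : Fin k) : strDist δ s y i = ilpDist δ x i := hy fun f e => δ (some f) (e i)
  exact ⟨y, fun i => by rw [hdist]; exact hx.2 i, hdist⟩

/-- The `δ`-Multi Strings problem is equivalent to its ILP formulation over
column types: (a) a feasible output string exists iff the ILP is feasible, and
(b) when feasible, the optimal objective values coincide. -/
theorem multiStrings_ilp_formulation
    (δ : Option α → Option α → ℕ) (hδ : ∀ e : α, δ (some e) none = 0)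
    (s : Fin k → Fin L → Option α) (d D : Fin k → ℕ) (b : ℕ) (hb : b ≤ 1) :
    ((∃ y, yFeas δ s d D y) ↔ (∃ x, xFeas δ s d D x)) ∧
    ((∃ y, yFeas δ s d D y) →
      sInf {M : ℕ | ∃ y, yFeas δ s d D y ∧ M = b * ∑ i, strDist δ s y i} =
      sInf {M : ℕ | ∃ x, xFeas δ s d D x ∧ M = b * ∑ i, ilpDist δ x i}) := by
  refine ⟨⟨fun ⟨_, hy⟩ => ?_, fun ⟨_, hx⟩ => ?_⟩, fun _ => congrArg sInf (Set.ext fun M => ?_)⟩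
  · obtain ⟨x, hx, _⟩ := exists_xFeas_of_yFeas hy
    exact ⟨x, hx⟩
  · obtain ⟨y, hy, _⟩ := exists_yFeas_of_xFeas hx
    exact ⟨y, hy⟩
  · constructor
    · rintro ⟨y, hy, rfl⟩
      obtain ⟨x, hx, hdist⟩ := exists_xFeas_of_yFeas hy
      exact ⟨x, hx, by simp only [hdist]⟩
    · rintro ⟨x, hx, rfl⟩
      obtain ⟨y, hy, hdist⟩ := exists_yFeas_of_xFeas hx
      exact ⟨y, hy, by simp only [hdist]⟩

end MultiStrings
end

section
/- Let T, r ∈ ℕ, t_1,…,t_T ∈ ℕ, let D_τ ∈ ℤ^{r×t_τ} for τ ∈ [T], set t = t_1 + ⋯ + t_T and D = (D_1 ⋯ D_T) ∈ ℤ^{r×t}. Let F be the matrix with first r rows (D_1 D_2 ⋯ D_T) and below them a block-diagonal pattern with the row vector 1ᵀ ∈ ℤ^{1×t_τ} in block τ, let b = (b^0, b^1,…,b^T) with b^0 ∈ ℤ^r and b^τ ∈ ℤ, let l, u ∈ ℤ^t, and let f : ℤ^t → ℤ be separable convex. Then there exist bounds l̂, û ∈ ℤ^{Tt} and a separable convex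 function f̂ : ℤ^{Tt} → ℤ (obtained by embedding the original coordinates block-wise via φ(τ, j) = (τ, t_1 + ⋯ + t_{τ−1} + j), fixing all coordinates without preimage to 0, and extending f by zero functions) such that, for E = (D; 1ᵀ) with 1ᵀ ∈ ℤ^{1×t}, the program min{f(x) : Fx = b, l ≤ x ≤ u, x ∈ ℤ^t} is feasible if and only if the combinatorial T-fold program min{f̂(x̂) : E^{(T)} x̂ = (b^0, b^1, …, b^T), l̂ ≤ x̂ ≤ û, x̂ ∈ ℤ^{Tt}} is feasible, and when feasible their minimum objective values are equal. -/
section PreNFold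

variable {T r : ℕ}

/-- A function `ℤ → ℤ` is convex iff its successive differences are nondecreasing. -/
def IntConvex (h : ℤ → ℤ) : Prop :=
  ∀ a b : ℤ, a ≤ b → h (a + 1) - h a ≤ h (b + 1) - h b

/-- A separable convex function: a sum of univariate convex integer functions
of the individual coordinates. -/
def SepConvex {ι : Type*} [Fintype ι] (f : (ι → ℤ) → ℤ) : Prop :=
  ∃ g : ι → ℤ → ℤ, (∀ i, IntConvex (g i)) ∧ ∀ x, f x = ∑ i, g i (x i)

/-- The `n`-fold product `E^{(n)}` of the bimatrix `E = (D; A)`, with a general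
column index type `ι`. -/
def nFoldG {r s : ℕ} {ι : Type*} (n : ℕ) (D : Matrix (Fin r) ι ℤ)
    (A : Matrix (Fin s) ι ℤ) :
    Matrix (Fin r ⊕ (Fin n × Fin s)) (Fin n × ι) ℤ :=
  Matrix.of fun I q =>
    match I with
    | Sum.inl a => D a q.2
    | Sum.inr ia => if q.1 = ia.1 then A ia.2 q.2 else 0

/-- The `1 × ι` all-ones row matrix `1ᵀ`. -/
def onesRowG (ι : Type*) : Matrix (Fin 1) ι ℤ := Matrix.of fun _ _ => 1

/-- The combinatorial pre-`n`-fold constraint matrix `F`: the blocks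
`D_1, …, D_T` concatenated horizontally in the top `r` rows, and
block-diagonal all-ones row vectors `1ᵀ ∈ ℤ^{1×t_τ}` below. The column index
is the sigma type `(τ : Fin T) × Fin (t_τ)`. -/
def preMat (tv : Fin T → ℕ)
    (Db : (τ : Fin T) → Matrix (Fin r) (Fin (tv τ)) ℤ) :
    Matrix (Fin r ⊕ Fin T) ((τ : Fin T) × Fin (tv τ)) ℤ :=
  Matrix.of fun I p =>
    match I with
    | Sum.inl a => Db p.1 a p.2
    | Sum.inr τ => if p.1 = τ then 1 else 0

/-- The horizontal concatenation `D = (D_1 ⋯ D_T)`. -/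
def Dfull (tv : Fin T → ℕ)
    (Db : (τ : Fin T) → Matrix (Fin r) (Fin (tv τ)) ℤ) :
    Matrix (Fin r) ((τ : Fin T) × Fin (tv τ)) ℤ :=
  Matrix.of fun a p => Db p.1 a p.2

/-- Embeds a vector into `T` bricks, placing block `τ` into brick `τ` and padding with `0`. -/
def blockEmbed {tv : Fin T → ℕ} (x : ((τ : Fin T) × Fin (tv τ)) → ℤ) :
    (Fin T × ((τ : Fin T) × Fin (tv τ))) → ℤ :=
  fun q => if q.2.1 = q.1 then x q.2 else 0

theorem sum_eq_sum_diag_of_offDiag_eq_zero {tv : Fin T → ℕ}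
    (F : (Fin T × ((τ : Fin T) × Fin (tv τ))) → ℤ) (hF : ∀ q, q.2.1 ≠ q.1 → F q = 0) :
    ∑ q, F q = ∑ p : (τ : Fin T) × Fin (tv τ), F (p.1, p) := by
  rw [Fintype.sum_prod_type_right]
  refine Finset.sum_congr rfl fun p _ => ?_
  exact Fintype.sum_eq_single p.1 fun τ hτ => hF (τ, p) hτ.symm

theorem SepConvex.comp_blockDiag {tv : Fin T → ℕ} {f : (((τ : Fin T) × Fin (tv τ)) → ℤ) → ℤ}
    (hf : SepConvex f) :
    SepConvex fun xh : (Fin T × ((τ : Fin T) × Fin (tv τ))) → ℤ => f fun p => xh (p.1, p) := by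
  obtain ⟨g, hg, hfg⟩ := hf
  refine ⟨fun q => if q.2.1 = q.1 then g q.2 else 0, fun q => ?_, fun xh => ?_⟩
  · dsimp only
    split_ifs
    · exact hg q.2
    · intro a b _
      simp
  · dsimp only
    rw [hfg, sum_eq_sum_diag_of_offDiag_eq_zero]
    · simp
    · intro q hq
      simp [hq]

theorem nFoldG_mulVec_blockEmbed (tv : Fin T → ℕ)
    (Db : (τ : Fin T) → Matrix (Fin r) (Fin (tv τ)) ℤ) (x : ((τ : Fin T) × Fin (tv τ)) → ℤ) :
    (nFoldG T (Dfull tv Db) (onesRowG ((τ : Fin T) × Fin (tv τ)))).mulVec (blockEmbed x) =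
      Sum.elim (fun a => (preMat tv Db).mulVec x (Sum.inl a))
        (fun q => (preMat tv Db).mulVec x (Sum.inr q.1)) := by
  ext I
  rw [Matrix.mulVec, dotProduct, sum_eq_sum_diag_of_offDiag_eq_zero]
  · rcases I with a | ⟨τ, i⟩ <;>
      simp [nFoldG, Dfull, onesRowG, preMat, blockEmbed, Matrix.mulVec, dotProduct]
  · intro q hq
    simp [blockEmbed, hq]

theorem nFoldG_mulVec_blockEmbed_eq_iff (tv : Fin T → ℕ)
    (Db : (τ : Fin T) → Matrix (Fin r) (Fin (tv τ)) ℤ) (x : ((τ : Fin T) × Fin (tv τ)) → ℤ)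
    (b0 : Fin r → ℤ) (bT : Fin T → ℤ) :
    (nFoldG T (Dfull tv Db) (onesRowG ((τ : Fin T) × Fin (tv τ)))).mulVec (blockEmbed x) =
        Sum.elim b0 (fun q : Fin T × Fin 1 => bT q.1) ↔
      (preMat tv Db).mulVec x = Sum.elim b0 bT := by
  rw [nFoldG_mulVec_blockEmbed]
  simp [funext_iff]

theorem blockEmbed_mem_bounds_iff {tv : Fin T → ℕ} (l u x : ((τ : Fin T) × Fin (tv τ)) → ℤ) :
    (∀ q, blockEmbed l q ≤ blockEmbed x q ∧ blockEmbed x q ≤ blockEmbed u q) ↔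
      ∀ p, l p ≤ x p ∧ x p ≤ u p := by
  refine ⟨fun h p => by simpa [blockEmbed] using h (p.1, p), fun h q => ?_⟩
  unfold blockEmbed
  split_ifs
  · exact h q.2
  · simp

theorem eq_blockEmbed_of_mem_bounds {tv : Fin T → ℕ} {l u : ((τ : Fin T) × Fin (tv τ)) → ℤ}
    {xh : (Fin T × ((τ : Fin T) × Fin (tv τ))) → ℤ}
    (h : ∀ q, blockEmbed l q ≤ xh q ∧ xh q ≤ blockEmbed u q) :
    xh = blockEmbed fun p => xh (p.1, p) := by
  ext ⟨τ, p⟩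
  by_cases hp : p.1 = τ
  · subst hp
    simp [blockEmbed]
  · have hq := h (τ, p)
    simp only [blockEmbed, hp, if_false] at hq ⊢
    exact le_antisymm hq.2 hq.1

/-- The feasible points of the combinatorial `T`-fold program are exactly the embedded feasible
points of the pre-`n`-fold program. -/
theorem nFoldG_feasible_iff (tv : Fin T → ℕ)
    (Db : (τ : Fin T) → Matrix (Fin r) (Fin (tv τ)) ℤ)
    (b0 : Fin r → ℤ) (bT : Fin T → ℤ) (l u : ((τ : Fin T) × Fin (tv τ)) → ℤ)
    (xh : (Fin T × ((τ : Fin T) × Fin (tv τ))) → ℤ) :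
    ((nFoldG T (Dfull tv Db) (onesRowG ((τ : Fin T) × Fin (tv τ)))).mulVec xh =
        Sum.elim b0 (fun q : Fin T × Fin 1 => bT q.1) ∧
      ∀ q, blockEmbed l q ≤ xh q ∧ xh q ≤ blockEmbed u q) ↔
    ∃ x, ((preMat tv Db).mulVec x = Sum.elim b0 bT ∧ ∀ p, l p ≤ x p ∧ x p ≤ u p) ∧
      xh = blockEmbed x := by
  constructor
  · rintro ⟨hb, hlu⟩
    have hx := eq_blockEmbed_of_mem_bounds hlu
    rw [hx] at hb hlu
    exact ⟨_, ⟨(nFoldG_mulVec_blockEmbed_eq_iff ..).1 hb,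
      (blockEmbed_mem_bounds_iff ..).1 hlu⟩, hx⟩
  · rintro ⟨x, ⟨hb, hlu⟩, rfl⟩
    exact ⟨(nFoldG_mulVec_blockEmbed_eq_iff ..).2 hb, (blockEmbed_mem_bounds_iff ..).2 hlu⟩

/-- Any combinatorial pre-`n`-fold IP can be written as a combinatorial
`T`-fold IP: embedding the original coordinates block-wise via
`φ(τ, j) = (τ, (τ, j))`, fixing all coordinates without preimage to `0`, and
extending `f` by zero functions yields bounds `l̂, û` and a separable convex
`f̂` such that feasibility and optimal values are preserved. -/
theorem pre_nfold_to_comb_nfold (tv : Fin T → ℕ)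
    (Db : (τ : Fin T) → Matrix (Fin r) (Fin (tv τ)) ℤ)
    (b0 : Fin r → ℤ) (bT : Fin T → ℤ)
    (l u : ((τ : Fin T) × Fin (tv τ)) → ℤ)
    (f : (((τ : Fin T) × Fin (tv τ)) → ℤ) → ℤ) (hf : SepConvex f) :
    ∃ (lhat uhat : (Fin T × ((τ : Fin T) × Fin (tv τ))) → ℤ)
      (fhat : ((Fin T × ((τ : Fin T) × Fin (tv τ))) → ℤ) → ℤ),
      SepConvex fhat ∧
      lhat = (fun q => if q.2.1 = q.1 then l q.2 else 0) ∧
      uhat = (fun q => if q.2.1 = q.1 then u q.2 else 0) ∧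
      fhat = (fun xh => f fun p => xh (p.1, p)) ∧
      ((∃ x, (preMat tv Db).mulVec x = Sum.elim b0 bT ∧
          ∀ p, l p ≤ x p ∧ x p ≤ u p) ↔
        (∃ xh, (nFoldG T (Dfull tv Db)
              (onesRowG ((τ : Fin T) × Fin (tv τ)))).mulVec xh =
            Sum.elim b0 (fun q : Fin T × Fin 1 => bT q.1) ∧
          ∀ q, lhat q ≤ xh q ∧ xh q ≤ uhat q)) ∧
      ((∃ x, (preMat tv Db).mulVec x = Sum.elim b0 bT ∧
          ∀ p, l p ≤ x p ∧ x p ≤ u p) →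
        sInf {v : ℤ | ∃ x, ((preMat tv Db).mulVec x = Sum.elim b0 bT ∧
            ∀ p, l p ≤ x p ∧ x p ≤ u p) ∧ v = f x} =
        sInf {v : ℤ | ∃ xh, ((nFoldG T (Dfull tv Db)
              (onesRowG ((τ : Fin T) × Fin (tv τ)))).mulVec xh =
            Sum.elim b0 (fun q : Fin T × Fin 1 => bT q.1) ∧
            ∀ q, lhat q ≤ xh q ∧ xh q ≤ uhat q) ∧ v = fhat xh}) := by
  refine ⟨blockEmbed l, blockEmbed u, _, hf.comp_blockDiag, rfl, rfl, rfl, ?_, fun _ => ?_⟩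
  · simp only [nFoldG_feasible_iff]
    exact ⟨fun ⟨x, hx⟩ => ⟨_, x, hx, rfl⟩, fun ⟨_, x, hx, _⟩ => ⟨x, hx⟩⟩
  · congr 1
    ext v
    simp only [nFoldG_feasible_iff, Set.mem_ofPred_eq]
    constructor
    · rintro ⟨x, hx, rfl⟩
      exact ⟨_, ⟨x, hx, rfl⟩, by simp [blockEmbed]⟩
    · rintro ⟨_, ⟨x, hx, rfl⟩, rfl⟩
      exact ⟨x, hx, by simp [blockEmbed]⟩

end PreNFold
end
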